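/- Let 1 ≤ k ≤ n−1 with 2k ≠ n. Then f : Λ^k → ℝ is affine (i.e., f(ω) = c + ⟨a; ω⟩ for some c ∈ ℝ and a ∈ Λ^k) if and only if f is both ext. one affine and int. one affine. -/

import Mathlib

/-! Basic setup: `Λᵏ(ℝⁿ)` in coordinates with respect to the standard basis
`e^I`, `I` a strictly increasing multi-index (modeled as a `k`-element subset of
`Fin n`), together with the exterior product, interior product, inner product,
Hodge star, and the various notions of one-directional convexity/affinity. -/

/-- Increasing multi-indices of length `k` in `{1,…,n}`: `k`-element subsets of `Fin n`.
`Idx n k` plays the role of `T_k`. -/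
abbrev Idx (n k : ℕ) := {s : Finset (Fin n) // s.card = k}

/-- `Λᵏ(ℝⁿ)`, identified with its coordinates in the standard basis `e^I`. -/
abbrev Lam (n k : ℕ) := Idx n k → ℝ

/-- The sign `sgn(R,S)` defined by `e^{[R,S]} = sgn(R,S) e^R ∧ e^S` for disjoint
increasing multi-indices: `(-1)` to the number of inversions between `R` and `S`. -/
def msign {n : ℕ} (R S : Finset (Fin n)) : ℝ :=
  (-1 : ℝ) ^ (((R ×ˢ S).filter (fun p => p.2 < p.1)).card)

/-- The basis form `e^S` (of degree `k = S.card`; zero if `k ≠ S.card`). -/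
def bform {n k : ℕ} (S : Finset (Fin n)) : Lam n k :=
  fun I => if I.1 = S then 1 else 0

/-- Exterior (wedge) product in coordinates.  When `m = k + l` this is the wedge
product `Λᵏ × Λˡ → Λ^{k+l}`; for other `m` it is `0`. -/
def wedge {n k l m : ℕ} (ω : Lam n k) (φ : Lam n l) : Lam n m :=
  fun I => ∑ R : Idx n k, ∑ S : Idx n l,
    if R.1 ∪ S.1 = I.1 ∧ Disjoint R.1 S.1 then msign R.1 S.1 * (ω R * φ S) else 0

/-- Interior product `a ⌟ b`, characterized by `⟨a ⌟ b; c⟩ = ⟨b; a ∧ c⟩`.  When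
`m = k - j` this is the interior product `Λʲ × Λᵏ → Λ^{k-j}`; for other `m` it is `0`. -/
def iprod {n j k m : ℕ} (a : Lam n j) (b : Lam n k) : Lam n m :=
  fun C => ∑ A : Idx n j, ∑ B : Idx n k,
    if A.1 ∪ C.1 = B.1 ∧ Disjoint A.1 C.1 then msign A.1 C.1 * (a A * b B) else 0

/-- Hodge star with respect to the standard orientation; when `m = n - k` this is
`∗ : Λᵏ → Λ^{n-k}`. -/
def hstar {n k m : ℕ} (ω : Lam n k) : Lam n m :=
  fun J => ∑ I : Idx n k, if I.1 = (J.1)ᶜ then msign I.1 J.1 * ω I else 0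

/-- Inner product `⟨·;·⟩` on `Λᵏ` (the basis `e^I` is orthonormal). -/
def ip {n k : ℕ} (ω α : Lam n k) : ℝ := ∑ I : Idx n k, ω I * α I

/-- `s`-fold exterior power `ω^s = ω ∧ ⋯ ∧ ω` (with `ω^0 = 1 ∈ Λ⁰`). -/
def lpow {n k : ℕ} (ω : Lam n k) : (s : ℕ) → Lam n (k * s)
  | 0 => bform ∅
  | s + 1 => wedge ω (lpow ω s)

/-- `f : Λᵏ → ℝ` is ext. one convex. -/
def ExtOneConvex {n k : ℕ} (f : Lam n k → ℝ) : Prop :=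
  ∀ (ω : Lam n k) (a : Lam n 1) (b : Lam n (k-1)),
    ConvexOn ℝ Set.univ (fun t : ℝ => f (ω + t • (wedge a b : Lam n k)))

/-- `f : Λᵏ → ℝ` is ext. one affine. -/
def ExtOneAffine {n k : ℕ} (f : Lam n k → ℝ) : Prop :=
  ExtOneConvex f ∧ ExtOneConvex (fun ω => -f ω)

/-- `f : Λᵏ → ℝ` is int. one convex. -/
def IntOneConvex {n k : ℕ} (f : Lam n k → ℝ) : Prop :=
  ∀ (ω : Lam n k) (a : Lam n 1) (b : Lam n (k+1)),
    ConvexOn ℝ Set.univ (fun t : ℝ => f (ω + t • (iprod a b : Lam n k)))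

/-- `f : Λᵏ → ℝ` is int. one affine. -/
def IntOneAffine {n k : ℕ} (f : Lam n k → ℝ) : Prop :=
  IntOneConvex f ∧ IntOneConvex (fun ω => -f ω)

/-- `f : Λ^{k+1} × Λ^{k-1} → ℝ` is ext-int. one convex. -/
def ExtIntOneConvex {n k : ℕ} (f : Lam n (k+1) → Lam n (k-1) → ℝ) : Prop :=
  ∀ (ξ : Lam n (k+1)) (η : Lam n (k-1)) (a : Lam n 1) (b : Lam n k),
    ConvexOn ℝ Set.univ
      (fun t : ℝ => f (ξ + t • (wedge a b : Lam n (k+1))) (η + t • (iprod a b : Lam n (k-1))))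

/-- `f : Λ^{k+1} × Λ^{k-1} → ℝ` is ext-int. one affine. -/
def ExtIntOneAffine {n k : ℕ} (f : Lam n (k+1) → Lam n (k-1) → ℝ) : Prop :=
  ExtIntOneConvex f ∧ ExtIntOneConvex (fun ξ η => -f ξ η)

/-- `g : Λᵏ → ℝ` is affine, i.e. a constant plus a linear functional. -/
def AffineFn {n k : ℕ} (g : Lam n k → ℝ) : Prop :=
  ∃ (c : ℝ) (a : Lam n k), ∀ ω, g ω = c + ip a ω

/-- Affinity of `f` along the direction `v`, in the form of convexity of `f` and `-f`. -/
def AffineAlong {V : Type*} [AddCommGroup V] [Module ℝ V] (f : V → ℝ) (v : V) : Prop :=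
  ∀ x, ConvexOn ℝ Set.univ (fun t : ℝ => f (x + t • v)) ∧
    ConvexOn ℝ Set.univ (fun t : ℝ => -f (x + t • v))

theorem eq_of_convexOn_of_convexOn_neg {g : ℝ → ℝ} (h₁ : ConvexOn ℝ Set.univ g)
    (h₂ : ConvexOn ℝ Set.univ (fun t => -g t)) (t : ℝ) : g t = g 0 + t * (g 1 - g 0) := by
  have key : ∀ x y r : ℝ, 0 ≤ r → r ≤ 1 →
      g ((1 - r) * x + r * y) = (1 - r) * g x + r * g y := by
    intro x y r h0 h1
    have e₁ := h₁.2 (Set.mem_univ x) (Set.mem_univ y) (sub_nonneg.2 h1) h0 (by ring)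
    have e₂ := h₂.2 (Set.mem_univ x) (Set.mem_univ y) (sub_nonneg.2 h1) h0 (by ring)
    simp only [smul_eq_mul] at e₁ e₂
    linarith
  rcases le_or_gt t 0 with ht | ht
  · have hpos : (0 : ℝ) < 1 - t := by linarith
    have := key 1 t (1 / (1 - t)) (by positivity) ((div_le_one hpos).2 (by linarith))
    rw [show (1 - 1 / (1 - t)) * 1 + 1 / (1 - t) * t = 0 by field_simp; ring] at this
    field_simp at this
    linarith
  rcases le_or_gt t 1 with ht1 | ht1
  · have := key 0 1 t ht.le ht1
    rw [show (1 - t) * 0 + t * 1 = t by ring] at this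
    linarith
  · have := key 0 t (1 / t) (by positivity) ((div_le_one ht).2 ht1.le)
    rw [show (1 - 1 / t) * 0 + 1 / t * t = 1 by field_simp; ring] at this
    field_simp at this
    linarith

theorem AffineAlong.apply_add_smul {V : Type*} [AddCommGroup V] [Module ℝ V] {f : V → ℝ} {v : V}
    (h : AffineAlong f v) (x : V) (t : ℝ) : f (x + t • v) = f x + t * (f (x + v) - f x) := by
  simpa using eq_of_convexOn_of_convexOn_neg (h x).1 (h x).2 t

theorem AffineAlong.apply_add_add {V : Type*} [AddCommGroup V] [Module ℝ V] {f : V → ℝ} {u v : V}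
    (hu : AffineAlong f u) (hv : AffineAlong f v) (huv : AffineAlong f (u - v)) (x : V) :
    f (x + u + v) - f (x + u) = f (x + v) - f x := by
  have e₁ := hu.apply_add_smul x 2
  have e₂ := hv.apply_add_smul x 2
  have e₃ := huv.apply_add_smul (x + (2 : ℝ) • v) 2
  have e₄ : x + (2 : ℝ) • v + (2 : ℝ) • (u - v) = x + (2 : ℝ) • u := by module
  have e₅ : x + (2 : ℝ) • v + (u - v) = x + u + v := by module
  rw [e₄, e₅] at e₃
  linarith

/-- A function on `ℝ^ι` that is affine along every combination of two coordinate directions is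
affine. -/
theorem eq_add_sum_of_affineAlong {ι : Type*} [Fintype ι] [DecidableEq ι] {f : (ι → ℝ) → ℝ}
    (h : ∀ (i j : ι) (s t : ℝ), AffineAlong f (Pi.single i s + Pi.single j t)) (ω : ι → ℝ) :
    f ω = f 0 + ∑ i, (f (Pi.single i 1) - f 0) * ω i := by
  have single : ∀ i s, AffineAlong f (Pi.single i s) := fun i s => by simpa using h i i s 0
  have shift : ∀ (i : ι) (t : ℝ) (x : ι → ℝ) (S : Finset ι),
      f (∑ j ∈ S, Pi.single j (x j) + Pi.single i t) - f (∑ j ∈ S, Pi.single j (x j)) =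
        f (Pi.single i t) - f 0 := by
    intro i t x S
    induction S using Finset.induction_on with
    | empty => simp
    | insert j S hj ih =>
      rw [Finset.sum_insert hj, add_comm (Pi.single (M := fun _ => ℝ) j (x j)), ← ih]
      refine (single j (x j)).apply_add_add (single i t) ?_ _
      simpa [sub_eq_add_neg, Pi.single_neg] using h j i (x j) (-t)
  have scale : ∀ (i : ι) (t : ℝ), f (Pi.single i t) - f 0 = (f (Pi.single i 1) - f 0) * t := by
    intro i t
    have := (single i 1).apply_add_smul 0 t
    rw [← Pi.single_smul, smul_eq_mul, mul_one, zero_add, zero_add] at this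
    rw [this]
    ring
  have hsum : ∀ S : Finset ι, f (∑ j ∈ S, Pi.single j (ω j)) =
      f 0 + ∑ j ∈ S, (f (Pi.single j 1) - f 0) * ω j := by
    intro S
    induction S using Finset.induction_on with
    | empty => simp
    | insert j S hj ih =>
      rw [Finset.sum_insert hj, Finset.sum_insert hj, add_comm (Pi.single (M := fun _ => ℝ) j (ω j))]
      have := shift j (ω j) ω S
      rw [scale] at this
      linarith
  simpa [Finset.univ_sum_single] using hsum Finset.univ

theorem msign_mul_self {n : ℕ} (R S : Finset (Fin n)) : msign R S * msign R S = 1 := by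
  rw [msign, ← mul_pow]
  simp

/-- A form all of whose multi-indices contain `i` is divisible by `e^i`. -/
theorem exists_wedge_eq {n k : ℕ} (i : Fin n) (v : Lam n k)
    (hv : ∀ K : Idx n k, i ∉ K.1 → v K = 0) :
    ∃ b : Lam n (k - 1), (wedge (bform {i} : Lam n 1) b : Lam n k) = v := by
  refine ⟨fun S => if h : (insert i S.1).card = k then msign {i} S.1 * v ⟨insert i S.1, h⟩ else 0,
    ?_⟩
  funext K
  unfold wedge
  rw [Finset.sum_eq_single (⟨{i}, by simp⟩ : Idx n 1)]
  · by_cases hi : i ∈ K.1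
    · rw [Finset.sum_eq_single
        (⟨K.1.erase i, by rw [Finset.card_erase_of_mem hi, K.2]⟩ : Idx n (k - 1))]
      · have hK : insert i (K.1.erase i) = K.1 := Finset.insert_erase hi
        have hc : (insert i (K.1.erase i)).card = k := by rw [hK, K.2]
        have hKK : (⟨insert i (K.1.erase i), hc⟩ : Idx n k) = K := Subtype.ext hK
        rw [if_pos ⟨by simpa using hK, by simp⟩]
        beta_reduce
        rw [dif_pos hc, hKK]
        simp only [bform, if_true, one_mul]
        rw [← mul_assoc, msign_mul_self, one_mul]
      · rintro S - hS
        refine if_neg fun h => hS (Subtype.ext ?_)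
        have hiS : i ∉ S.1 := by simpa using h.2
        change S.1 = K.1.erase i
        rw [← h.1, ← Finset.insert_eq, Finset.erase_insert hiS]
      · simp
    · rw [hv K hi]
      refine Finset.sum_eq_zero fun S _ => if_neg fun h => hi ?_
      rw [← h.1]
      simp
  · rintro R - hR
    have : R.1 ≠ {i} := fun h => hR (Subtype.ext h)
    simp [bform, this]
  · simp

/-- A form none of whose multi-indices contains `i` is an interior product by `e^i`. -/
theorem exists_iprod_eq {n k : ℕ} (i : Fin n) (v : Lam n k)
    (hv : ∀ K : Idx n k, i ∈ K.1 → v K = 0) :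
    ∃ b : Lam n (k + 1), (iprod (bform {i} : Lam n 1) b : Lam n k) = v := by
  refine ⟨fun B => if h : (B.1.erase i).card = k then
    msign {i} (B.1.erase i) * v ⟨B.1.erase i, h⟩ else 0, ?_⟩
  funext K
  unfold iprod
  rw [Finset.sum_eq_single (⟨{i}, by simp⟩ : Idx n 1)]
  · by_cases hi : i ∈ K.1
    · rw [hv K hi]
      exact Finset.sum_eq_zero fun B _ => if_neg fun h => by simp [hi] at h
    · rw [Finset.sum_eq_single
        (⟨insert i K.1, by rw [Finset.card_insert_of_notMem hi, K.2]⟩ : Idx n (k + 1))]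
      · have hK : (insert i K.1).erase i = K.1 := Finset.erase_insert hi
        have hc : ((insert i K.1).erase i).card = k := by rw [hK, K.2]
        have hKK : (⟨(insert i K.1).erase i, hc⟩ : Idx n k) = K := Subtype.ext hK
        rw [if_pos ⟨by simp, by simpa using hi⟩]
        beta_reduce
        rw [dif_pos hc, hKK]
        simp only [bform, if_true, one_mul, hK]
        rw [← mul_assoc, msign_mul_self, one_mul]
      · rintro B - hB
        refine if_neg fun h => hB (Subtype.ext ?_)
        change B.1 = insert i K.1
        rw [← h.1, ← Finset.insert_eq]
      · simp
  · rintro R - hR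
    have : R.1 ≠ {i} := fun h => hR (Subtype.ext h)
    simp [bform, this]
  · simp

/-- Unless `I` and `J` are complementary, some index lies in both or in neither. -/
theorem exists_mem_inter_or_notMem_union {n k : ℕ} (h2k : 2 * k ≠ n) (I J : Idx n k) :
    ∃ i, (i ∈ I.1 ∧ i ∈ J.1) ∨ (i ∉ I.1 ∧ i ∉ J.1) := by
  by_contra! h
  have hJ : J.1 = I.1ᶜ := by
    ext i
    rw [Finset.mem_compl]
    exact ⟨fun hj hi => (h i).1 hi hj, fun hi => (h i).2 hi⟩
  have hc := Finset.card_add_card_compl I.1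
  rw [← hJ, I.2, J.2, Fintype.card_fin] at hc
  omega

theorem affineAlong_single_add_single {n k : ℕ} (h2k : 2 * k ≠ n) {f : Lam n k → ℝ}
    (he : ExtOneAffine f) (hi : IntOneAffine f) (I J : Idx n k) (s t : ℝ) :
    AffineAlong f (Pi.single I s + Pi.single J t) := by
  have vanish : ∀ K : Idx n k, K ≠ I → K ≠ J →
      (Pi.single I s + Pi.single J t : Lam n k) K = 0 := by
    intro K hKI hKJ
    simp [hKI, hKJ]
  obtain ⟨i, ⟨hI, hJ⟩ | ⟨hI, hJ⟩⟩ := exists_mem_inter_or_notMem_union h2k I J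
  · obtain ⟨b, hb⟩ := exists_wedge_eq i (Pi.single I s + Pi.single J t) fun K hK =>
      vanish K (by rintro rfl; exact hK hI) (by rintro rfl; exact hK hJ)
    rw [← hb]
    exact fun x => ⟨he.1 x _ b, he.2 x _ b⟩
  · obtain ⟨b, hb⟩ := exists_iprod_eq i (Pi.single I s + Pi.single J t) fun K hK =>
      vanish K (by rintro rfl; exact hI hK) (by rintro rfl; exact hJ hK)
    rw [← hb]
    exact fun x => ⟨hi.1 x _ b, hi.2 x _ b⟩

theorem affineAlong_const_add_ip {n k : ℕ} (c : ℝ) (a v : Lam n k) :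
    AffineAlong (fun ω => c + ip a ω) v := by
  have expand : ∀ (x : Lam n k) (t : ℝ), ip a (x + t • v) = ip a x + t * ip a v := by
    intro x t
    simp only [ip, Pi.add_apply, Pi.smul_apply, smul_eq_mul, Finset.mul_sum,
      ← Finset.sum_add_distrib]
    exact Finset.sum_congr rfl fun I _ => by ring
  refine fun x => ⟨⟨convex_univ, fun s _ t _ p q _ _ hpq => le_of_eq ?_⟩,
    ⟨convex_univ, fun s _ t _ p q _ _ hpq => le_of_eq ?_⟩⟩ <;>
  · obtain rfl : q = 1 - p := by linarith
    simp only [expand, smul_eq_mul]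
    ring

/-- **Theorem.** Let `1 ≤ k ≤ n-1` with `2k ≠ n`.  Then `f : Λᵏ → ℝ` is affine
(i.e. `f(ω) = c + ⟨a;ω⟩`) iff `f` is both ext. one affine and int. one affine. -/
theorem stmt4 {n k : ℕ} (hk : 1 ≤ k) (hkn : k ≤ n - 1) (h2k : 2 * k ≠ n)
    (f : Lam n k → ℝ) :
    (∃ (c : ℝ) (a : Lam n k), ∀ ω, f ω = c + ip a ω) ↔ ExtOneAffine f ∧ IntOneAffine f := by
  constructor
  · rintro ⟨c, a, h⟩
    obtain rfl : f = fun ω => c + ip a ω := funext h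
    exact ⟨⟨fun ω _ _ => (affineAlong_const_add_ip c a _ ω).1,
        fun ω _ _ => (affineAlong_const_add_ip c a _ ω).2⟩,
      ⟨fun ω _ _ => (affineAlong_const_add_ip c a _ ω).1,
        fun ω _ _ => (affineAlong_const_add_ip c a _ ω).2⟩⟩
  · rintro ⟨he, hi⟩
    exact ⟨f 0, fun I => f (Pi.single I 1) - f 0,
      eq_add_sum_of_affineAlong (affineAlong_single_add_single h2k he hi)⟩
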